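/- arXiv:2409.19950 — 17 statements merged into one kernel-verified Lean document; each statement's English description precedes it below -/
import Mathlib

section
/- Let R be a commutative ring with identity and let P be a nil-prime ideal of R. Then the radical √P of P is a prime ideal of R. -/
/-- A proper ideal `P` of a commutative ring `R` is a *nil-prime ideal* if there exists a
nilpotent element `x` such that whenever `a * b ∈ P`, we have `a ∈ P` or `b ∈ P` or
`a + x ∈ P` or `b + x ∈ P`. -/
def IsNilPrime {R : Type*} [CommRing R] (P : Ideal R) : Prop :=
  P ≠ ⊤ ∧ ∃ x ∈ nilradical R, ∀ a b : R, a * b ∈ P →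
    a ∈ P ∨ b ∈ P ∨ a + x ∈ P ∨ b + x ∈ P

theorem radical_isPrime_of_isNilPrime {R : Type*} [CommRing R] (P : Ideal R)
    (hP : IsNilPrime P) : (P.radical).IsPrime := by
  obtain ⟨hne, x, hx, h⟩ := hP
  have hxr : x ∈ P.radical := Ideal.radical_mono bot_le hx
  have mem_of_add {c : R} {n : ℕ} (hc : c ^ n + x ∈ P) : c ∈ P.radical :=
    P.radical_isRadical ⟨n, (Ideal.add_mem_iff_left _ hxr).1 (Ideal.le_radical hc)⟩
  refine ⟨mt Ideal.radical_eq_top.1 hne, ?_⟩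
  rintro a b ⟨n, hn⟩
  rw [mul_pow] at hn
  rcases h _ _ hn with ha | hb | ha | hb
  · exact Or.inl ⟨n, ha⟩
  · exact Or.inr ⟨n, hb⟩
  · exact Or.inl (mem_of_add ha)
  · exact Or.inr (mem_of_add hb)
end

section
/- Let R be a commutative ring with identity and let P be a nil-prime ideal of R with respect to x (so x ∈ Nil(R) witnesses the nil-prime condition). Then 2x ∈ P. -/
theorem two_mul_mem_of_isNilPrime_wrt {R : Type*} [CommRing R] (P : Ideal R) (x : R)
    (hP : P ≠ ⊤) (hx : x ∈ nilradical R)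
    (h : ∀ a b : R, a * b ∈ P → a ∈ P ∨ b ∈ P ∨ a + x ∈ P ∨ b + x ∈ P) :
    2 * x ∈ P := by
  classical
  have hpow : ∃ n, x ^ n ∈ P := by
    obtain ⟨n, hn⟩ := mem_nilradical.mp hx
    exact ⟨n, hn ▸ P.zero_mem⟩
  obtain ⟨n, hn, hmin⟩ : ∃ n, x ^ n ∈ P ∧ ∀ m < n, x ^ m ∉ P :=
    ⟨Nat.find hpow, Nat.find_spec hpow, fun _ => Nat.find_min hpow⟩
  match n with
  | 0 => exact absurd ((Ideal.eq_top_iff_one P).mpr (by simpa using hn)) hP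
  | 1 => exact P.mul_mem_left 2 (by simpa using hn)
  | m + 2 =>
    rcases h x (x ^ (m + 1)) (by rwa [← pow_succ']) with h1 | h1 | h1 | h1
    · exact P.mul_mem_left 2 h1
    · exact absurd h1 (hmin _ (by lia))
    · rwa [two_mul]
    · rcases m with _ | k
      · simpa [two_mul] using h1
      · refine absurd ?_ (hmin (k + 2) (by lia))
        have h2 := P.sub_mem (P.mul_mem_left (x ^ (k + 1)) h1) (P.mul_mem_left (x ^ k) hn)
        convert h2 using 1
        ring
end

section
/- Let R be a commutative ring with identity and let P be a nil-prime ideal of R with respect to x. Then for each a, b ∈ R with a ∉ P, b ∉ P and ab ∈ P, we have 2a ∈ P or 2b ∈ P. -/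
theorem two_mul_mem_of_add_mem_of_neg_add_mem {R : Type*} [CommRing R] {P : Ideal R} {x a : R}
    (h₁ : a + x ∈ P) (h₂ : -a + x ∈ P) : 2 * a ∈ P := by
  convert P.sub_mem h₁ h₂ using 1
  ring

theorem two_mul_mem_or_two_mul_mem_of_isNilPrime_wrt {R : Type*} [CommRing R] (P : Ideal R)
    (x : R) (hP : P ≠ ⊤) (hx : x ∈ nilradical R)
    (h : ∀ a b : R, a * b ∈ P → a ∈ P ∨ b ∈ P ∨ a + x ∈ P ∨ b + x ∈ P)
    (a b : R) (ha : a ∉ P) (hb : b ∉ P) (hab : a * b ∈ P) :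
    2 * a ∈ P ∨ 2 * b ∈ P := by
  have hpp := h a b hab
  have hnp := h (-a) b (by simpa using hab)
  have hpn := h a (-b) (by simpa using hab)
  have hnn := h (-a) (-b) (by simpa using hab)
  rw [neg_mem_iff] at hnp hnn
  rw [neg_mem_iff (x := b)] at hpn hnn
  have hA := two_mul_mem_of_add_mem_of_neg_add_mem (P := P) (x := x) (a := a)
  have hB := two_mul_mem_of_add_mem_of_neg_add_mem (P := P) (x := x) (a := b)
  tauto
end

section
/- Let R be a commutative ring with identity. If P is a nil-maximal ideal of R, then P is an 𝔑-prime ideal of R, i.e., for all a, b ∈ R with ab ∈ P one has a ∈ P + Nil(R) or b ∈ P + Nil(R). -/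
/-- A proper ideal `M` of a commutative ring `R` is a *nil-maximal ideal* if there exists a
nilpotent element `x` such that whenever `M ⊆ I ⊆ R` for an ideal `I`, then `I = M` or
`I = M + Rx` or `I = R`. -/
def IsNilMaximal {R : Type*} [CommRing R] (M : Ideal R) : Prop :=
  M ≠ ⊤ ∧ ∃ x ∈ nilradical R, ∀ I : Ideal R, M ≤ I →
    I = M ∨ I = M + Ideal.span {x} ∨ I = ⊤

theorem nPrime_of_nilMaximal {R : Type*} [CommRing R] (P : Ideal R)
    (hP : IsNilMaximal P) :
    ∀ a b : R, a * b ∈ P → a ∈ P + nilradical R ∨ b ∈ P + nilradical R := by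
  obtain ⟨-, x, hx, hmax⟩ := hP
  intro a b hab
  have ha : a ∈ P + Ideal.span {a} :=
    Ideal.mem_sup_right (Ideal.mem_span_singleton_self a)
  rcases hmax (P + Ideal.span {a}) le_sup_left with h | h | h
  · exact Or.inl (Ideal.mem_sup_left (h ▸ ha))
  · have hle : P + Ideal.span {x} ≤ P + nilradical R :=
      sup_le_sup_left ((Ideal.span_singleton_le_iff_mem _).2 hx) P
    exact Or.inl (hle (h ▸ ha))
  · right
    obtain ⟨p, hp, y, hy, hpy⟩ := Submodule.mem_sup.1 ((Ideal.eq_top_iff_one _).1 h)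
    obtain ⟨r, rfl⟩ := Ideal.mem_span_singleton'.1 hy
    have hb : b = b * p + r * (a * b) := by linear_combination -b * hpy
    rw [hb]
    exact Ideal.mem_sup_left (P.add_mem (P.mul_mem_left b hp) (P.mul_mem_left r hab))
end

section
/- Let f : R → S be a surjective ring homomorphism between commutative rings with identity and let P be a nil-prime ideal of R such that ker(f) ⊆ P. Then the image f(P) is a nil-prime ideal of S. -/
theorem map_isNilPrime_of_surjective {R S : Type*} [CommRing R] [CommRing S]
    (f : R →+* S) (hf : Function.Surjective f) (P : Ideal R) (hP : IsNilPrime P)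
    (hker : RingHom.ker f ≤ P) : IsNilPrime (P.map f) := by
  have hcomap : (P.map f).comap f = P := by
    rw [Ideal.comap_map_of_surjective' f hf, sup_eq_left.2 hker]
  have hmem (a : R) : f a ∈ P.map f ↔ a ∈ P := by
    rw [← Ideal.mem_comap, hcomap]
  obtain ⟨hne, x, hx, hprime⟩ := hP
  refine ⟨fun htop => hne (by rw [← hcomap, htop, Ideal.comap_top]), f x,
    mem_nilradical.2 ((mem_nilradical.1 hx).map f), fun s t hst => ?_⟩
  obtain ⟨a, rfl⟩ := hf s
  obtain ⟨b, rfl⟩ := hf t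
  simp only [← map_mul, ← map_add, hmem] at hst ⊢
  exact hprime a b hst
end

section
/- Let R be a commutative ring with identity, let I be an ideal of R, and let P be a nil-prime ideal of R with I ⊆ P. Then the image P/I of P in the quotient ring R/I is a nil-prime ideal of R/I. -/
theorem quotient_isNilPrime {R : Type*} [CommRing R] (I P : Ideal R)
    (hIP : I ≤ P) (hP : IsNilPrime P) :
    IsNilPrime (P.map (Ideal.Quotient.mk I)) := by
  obtain ⟨hne, x, hx, h⟩ := hP
  have hmem (a : R) : Ideal.Quotient.mk I a ∈ P.map (Ideal.Quotient.mk I) ↔ a ∈ P :=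
    Ideal.mem_quotient_iff_mem hIP
  refine ⟨?_, Ideal.Quotient.mk I x, ?_, ?_⟩
  · rw [Ideal.ne_top_iff_one] at hne ⊢
    rwa [← map_one (Ideal.Quotient.mk I), hmem]
  · rw [mem_nilradical] at hx ⊢
    exact hx.map _
  · intro a b hab
    obtain ⟨a, rfl⟩ := Ideal.Quotient.mk_surjective a
    obtain ⟨b, rfl⟩ := Ideal.Quotient.mk_surjective b
    simp only [← map_add, ← map_mul, hmem] at hab ⊢
    exact h a b hab
end

section
/- Let R be a commutative ring with identity and let P be a proper ideal of R. If the ideal ⟨P, X⟩ of the polynomial ring R[X] generated by P and X is a nil-prime ideal of R[X], then P is a nil-prime ideal of R. -/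
theorem constantCoeff_mem_of_mem_map_C_add_span_X {R : Type*} [CommRing R] {P : Ideal R}
    {f : Polynomial R}
    (hf : f ∈ P.map (Polynomial.C : R →+* Polynomial R) +
      Ideal.span {(Polynomial.X : Polynomial R)}) :
    Polynomial.constantCoeff f ∈ P := by
  have hle : P.map (Polynomial.C : R →+* Polynomial R) +
      Ideal.span {(Polynomial.X : Polynomial R)} ≤ P.comap Polynomial.constantCoeff := by
    refine sup_le (Ideal.map_le_iff_le_comap.2 fun a ha => ?_) ?_
    · simpa using ha
    · simp [Ideal.span_le]
  exact hle hf

theorem isNilPrime_of_isNilPrime_span_insert_X {R : Type*} [CommRing R]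
    (P : Ideal R) (hP : P ≠ ⊤)
    (h : IsNilPrime (P.map (Polynomial.C : R →+* Polynomial R) +
      Ideal.span {(Polynomial.X : Polynomial R)})) :
    IsNilPrime P := by
  obtain ⟨-, x, hx, h⟩ := h
  refine ⟨hP, Polynomial.constantCoeff x,
    mem_nilradical.2 ((mem_nilradical.1 hx).map Polynomial.constantCoeff), fun a b hab => ?_⟩
  have hC : Polynomial.C a * Polynomial.C b ∈ P.map (Polynomial.C : R →+* Polynomial R) +
      Ideal.span {(Polynomial.X : Polynomial R)} := by
    rw [← Polynomial.C_mul]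
    exact Ideal.mem_sup_left (Ideal.mem_map_of_mem _ hab)
  rcases h _ _ hC with h | h | h | h <;>
    have := constantCoeff_mem_of_mem_map_C_add_span_X h <;>
    simp_all
end

section
/- Let R₁ and R₂ be commutative rings with identity, let R = R₁ × R₂, and let P = P₁ × P₂ where Pᵢ is an ideal of Rᵢ for i = 1, 2. Then P is a nil-prime ideal of R if and only if either (P₁ is a nil-prime ideal of R₁ and P₂ = R₂) or (P₁ = R₁ and P₂ is a nil-prime ideal of R₂). -/
theorem Ideal.eq_top_of_one_add_mem {R : Type*} [CommRing R] {P : Ideal R} {x : R}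
    (hx : IsNilpotent x) (h : 1 + x ∈ P) : P = ⊤ :=
  P.eq_top_of_isUnit_mem h hx.isUnit_one_add

theorem IsNilPrime.eq_top_or_eq_top {R₁ R₂ : Type*} [CommRing R₁] [CommRing R₂]
    {P₁ : Ideal R₁} {P₂ : Ideal R₂} (h : IsNilPrime (P₁.prod P₂)) : P₁ = ⊤ ∨ P₂ = ⊤ := by
  obtain ⟨-, x, hx, h⟩ := h
  rw [mem_nilradical] at hx
  have h₁ : IsNilpotent x.1 := hx.map (RingHom.fst R₁ R₂)
  have h₂ : IsNilpotent x.2 := hx.map (RingHom.snd R₁ R₂)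
  rcases h (1, 0) (0, 1) (by simp [Ideal.mem_prod]) with h | h | h | h
  · exact .inl (P₁.eq_top_iff_one.2 h.1)
  · exact .inr (P₂.eq_top_iff_one.2 h.2)
  · exact .inl (Ideal.eq_top_of_one_add_mem h₁ h.1)
  · exact .inr (Ideal.eq_top_of_one_add_mem h₂ h.2)

theorem isNilPrime_prod_top_iff {R₁ R₂ : Type*} [CommRing R₁] [CommRing R₂] {P₁ : Ideal R₁} :
    IsNilPrime (P₁.prod (⊤ : Ideal R₂)) ↔ IsNilPrime P₁ := by
  refine and_congr (by simp [Ideal.ne_top_iff_one]) ⟨?_, ?_⟩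
  · rintro ⟨x, hx, h⟩
    refine ⟨x.1, IsNilpotent.map (mem_nilradical.1 hx) (RingHom.fst R₁ R₂), fun a b hab ↦ ?_⟩
    simpa [Ideal.mem_prod] using h (a, 0) (b, 0) (by simpa [Ideal.mem_prod] using hab)
  · rintro ⟨x, hx, h⟩
    obtain ⟨n, hn⟩ := mem_nilradical.1 hx
    refine ⟨(x, 0), mem_nilradical.2 ⟨n + 1, by ext <;> simp [pow_succ, hn]⟩, fun a b hab ↦ ?_⟩
    simpa [Ideal.mem_prod] using h a.1 b.1 hab.1

theorem isNilPrime_top_prod_iff {R₁ R₂ : Type*} [CommRing R₁] [CommRing R₂] {P₂ : Ideal R₂} :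
    IsNilPrime ((⊤ : Ideal R₁).prod P₂) ↔ IsNilPrime P₂ := by
  refine and_congr (by simp [Ideal.ne_top_iff_one]) ⟨?_, ?_⟩
  · rintro ⟨x, hx, h⟩
    refine ⟨x.2, IsNilpotent.map (mem_nilradical.1 hx) (RingHom.snd R₁ R₂), fun a b hab ↦ ?_⟩
    simpa [Ideal.mem_prod] using h (0, a) (0, b) (by simpa [Ideal.mem_prod] using hab)
  · rintro ⟨x, hx, h⟩
    obtain ⟨n, hn⟩ := mem_nilradical.1 hx
    refine ⟨(0, x), mem_nilradical.2 ⟨n + 1, by ext <;> simp [pow_succ, hn]⟩, fun a b hab ↦ ?_⟩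
    simpa [Ideal.mem_prod] using h a.2 b.2 hab.2

theorem isNilPrime_prod_iff {R₁ R₂ : Type*} [CommRing R₁] [CommRing R₂]
    (P₁ : Ideal R₁) (P₂ : Ideal R₂) :
    IsNilPrime (P₁.prod P₂) ↔
      (IsNilPrime P₁ ∧ P₂ = ⊤) ∨ (P₁ = ⊤ ∧ IsNilPrime P₂) := by
  constructor
  · intro h
    rcases h.eq_top_or_eq_top with rfl | rfl
    · exact .inr ⟨rfl, isNilPrime_top_prod_iff.1 h⟩
    · exact .inl ⟨isNilPrime_prod_top_iff.1 h, rfl⟩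
  · rintro (⟨h, rfl⟩ | ⟨rfl, h⟩)
    · exact isNilPrime_prod_top_iff.2 h
    · exact isNilPrime_top_prod_iff.2 h
end

section
/- Let n ≥ 2, let R₁, …, Rₙ be commutative rings with identity, let R = R₁ × R₂ × ⋯ × Rₙ, and let P = P₁ × P₂ × ⋯ × Pₙ where Pᵢ is an ideal of Rᵢ for 1 ≤ i ≤ n. Then P is a nil-prime ideal of R if and only if there exists j ∈ {1, 2, …, n} such that Pⱼ is a nil-prime ideal of Rⱼ and Pᵢ = Rᵢ for each i ≠ j. -/
/-- The ideal `P₁ × ⋯ × Pₙ` of the product ring `R₁ × ⋯ × Rₙ`. -/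
def Ideal.piProd {n : ℕ} {R : Fin n → Type*} [∀ i, CommRing (R i)]
    (P : ∀ i, Ideal (R i)) : Ideal (∀ i, R i) where
  carrier := {f | ∀ i, f i ∈ P i}
  add_mem' := fun hf hg i => (P _).add_mem (hf i) (hg i)
  zero_mem' := fun i => (P i).zero_mem
  smul_mem' := fun c _ hf i => (P _).smul_mem (c i) (hf i)

theorem Ideal.mem_piProd {n : ℕ} {R : Fin n → Type*} [∀ i, CommRing (R i)]
    {P : ∀ i, Ideal (R i)} {f : ∀ i, R i} : f ∈ Ideal.piProd P ↔ ∀ i, f i ∈ P i :=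
  Iff.rfl

theorem Ideal.mem_piProd_iff_of_forall_ne_eq_top {n : ℕ} {R : Fin n → Type*}
    [∀ i, CommRing (R i)] {P : ∀ i, Ideal (R i)} {j : Fin n} (h : ∀ i, i ≠ j → P i = ⊤)
    {f : ∀ i, R i} : f ∈ Ideal.piProd P ↔ f j ∈ P j := by
  refine ⟨fun hf => hf j, fun hf i => ?_⟩
  obtain rfl | hij := eq_or_ne i j
  · exact hf
  · simp [h i hij]

theorem Ideal.piProd_ne_top_iff {n : ℕ} {R : Fin n → Type*} [∀ i, CommRing (R i)]
    {P : ∀ i, Ideal (R i)} : Ideal.piProd P ≠ ⊤ ↔ ∃ j, P j ≠ ⊤ := by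
  simp only [Ideal.ne_top_iff_one, Ideal.mem_piProd, Pi.one_apply, not_forall]

theorem Ideal.one_add_notMem_of_isNilpotent {R : Type*} [CommRing R] {I : Ideal R}
    (hI : I ≠ ⊤) {x : R} (hx : IsNilpotent x) : 1 + x ∉ I :=
  fun h => hI (I.eq_top_of_isUnit_mem h hx.isUnit_one_add)

/-- A nil-prime product ideal has at most one proper component. -/
theorem IsNilPrime.eq_top_of_ne {n : ℕ} {R : Fin n → Type*} [∀ i, CommRing (R i)]
    {P : ∀ i, Ideal (R i)} (h : IsNilPrime (Ideal.piProd P)) {i j : Fin n} (hj : P j ≠ ⊤)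
    (hij : i ≠ j) : P i = ⊤ := by
  by_contra hi
  obtain ⟨-, x, hx, hP⟩ := h
  have hx' (k : Fin n) : IsNilpotent (x k) :=
    (mem_nilradical.mp hx).map (Pi.evalRingHom R k)
  have hmul : (Pi.single j 1 : ∀ k, R k) * (1 - Pi.single j 1) ∈ Ideal.piProd P := by
    rw [mul_sub, mul_one, ← Pi.single_mul, mul_one, sub_self]
    exact zero_mem _
  obtain h | h | h | h := hP _ _ hmul
  · exact (Ideal.ne_top_iff_one _).mp hj (by simpa using h j)
  · exact (Ideal.ne_top_iff_one _).mp hi (by simpa [hij] using h i)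
  · exact Ideal.one_add_notMem_of_isNilpotent hj (hx' j) (by simpa using h j)
  · exact Ideal.one_add_notMem_of_isNilpotent hi (hx' i) (by simpa [hij] using h i)

theorem isNilPrime_piProd_iff_of_forall_ne_eq_top {n : ℕ} {R : Fin n → Type*}
    [∀ i, CommRing (R i)] {P : ∀ i, Ideal (R i)} {j : Fin n} (h : ∀ i, i ≠ j → P i = ⊤) :
    IsNilPrime (Ideal.piProd P) ↔ IsNilPrime (P j) := by
  simp only [IsNilPrime, Ideal.ne_top_iff_one, Ideal.mem_piProd_iff_of_forall_ne_eq_top h,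
    Pi.one_apply, Pi.mul_apply, Pi.add_apply, mem_nilradical]
  refine and_congr_right fun _ => ⟨?_, ?_⟩
  · rintro ⟨x, hx, hP⟩
    exact ⟨x j, hx.map (Pi.evalRingHom R j), fun a b hab => by
      simpa using hP (Pi.single j a) (Pi.single j b) (by simpa using hab)⟩
  · rintro ⟨x, ⟨k, hk⟩, hP⟩
    refine ⟨Pi.single j x, ⟨k + 1, ?_⟩, fun a b hab => by simpa using hP (a j) (b j) hab⟩
    ext i
    obtain rfl | hij := eq_or_ne i j
    · simp [pow_succ, hk]
    · simp [hij]

theorem isNilPrime_piProd_iff {n : ℕ} (hn : 2 ≤ n) {R : Fin n → Type*}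
    [∀ i, CommRing (R i)] (P : ∀ i, Ideal (R i)) :
    IsNilPrime (Ideal.piProd P) ↔
      ∃ j, IsNilPrime (P j) ∧ ∀ i, i ≠ j → P i = ⊤ := by
  constructor
  · intro h
    obtain ⟨j, hj⟩ := Ideal.piProd_ne_top_iff.mp h.1
    have htop : ∀ i, i ≠ j → P i = ⊤ := fun i hij => h.eq_top_of_ne hj hij
    exact ⟨j, (isNilPrime_piProd_iff_of_forall_ne_eq_top htop).mp h, htop⟩
  · rintro ⟨j, hj, htop⟩
    exact (isNilPrime_piProd_iff_of_forall_ne_eq_top htop).mpr hj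
end

section
/- Let R be a commutative ring with identity, M an R-module, P an ideal of R, and N a proper submodule of M such that PM ⊆ N. If the homogeneous ideal P ⊕ N of the idealization R ⊕ M is a nil-prime ideal of R ⊕ M with respect to the nilpotent element (x, m), then m ∈ M \ N, x ∈ P, and 2m ∈ N. -/
open TrivSqZeroExt

theorem idealization_nilPrime_wrt_props {R M : Type*} [CommRing R] [AddCommGroup M]
    [Module R M] [Module Rᵐᵒᵖ M] [IsCentralScalar R M]
    (P : Ideal R) (N : Submodule R M) (hN : N ≠ ⊤)
    (hPM : ∀ p ∈ P, ∀ m : M, p • m ∈ N)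
    (Q : Ideal (TrivSqZeroExt R M))
    (hQ : ∀ z : TrivSqZeroExt R M, z ∈ Q ↔ z.fst ∈ P ∧ z.snd ∈ N)
    (x : R) (m : M)
    (hnil : (inl x + inr m : TrivSqZeroExt R M) ∈ nilradical (TrivSqZeroExt R M))
    (hQtop : Q ≠ ⊤)
    (h : ∀ a b : TrivSqZeroExt R M, a * b ∈ Q →
      a ∈ Q ∨ b ∈ Q ∨ a + (inl x + inr m) ∈ Q ∨ b + (inl x + inr m) ∈ Q) :
    m ∉ N ∧ x ∈ P ∧ 2 • m ∈ N := by
  have key : ∀ n : M, n ∉ N → x ∈ P ∧ n + m ∈ N := by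
    intro n hn
    have hmul : (inr n * inr n : TrivSqZeroExt R M) ∈ Q := by
      rw [inr_mul_inr]
      exact Q.zero_mem
    have hnot : (inr n : TrivSqZeroExt R M) ∉ Q := fun hmem => hn ((hQ _).1 hmem).2
    have hadd : (inr n + (inl x + inr m) : TrivSqZeroExt R M) ∈ Q := by
      have := h _ _ hmul
      tauto
    simpa using (hQ _).1 hadd
  obtain ⟨n, hn⟩ : ∃ n, n ∉ N := by
    by_contra! hall
    exact hN (Submodule.eq_top_iff'.2 hall)
  have hm : m ∉ N := fun hm => hn ((N.add_mem_iff_left hm).1 (key n hn).2)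
  exact ⟨hm, (key n hn).1, two_nsmul m ▸ (key m hm).2⟩
end

section
/- Let R be a commutative ring with identity, M an R-module, P an ideal of R, and N a proper submodule of M such that PM ⊆ N. If the homogeneous ideal P ⊕ N of the idealization R ⊕ M is a nil-prime ideal of R ⊕ M with respect to the nilpotent element (x, m), then for each m₁ ∈ M \ N we have 2m₁ ∈ N. -/
open TrivSqZeroExt

theorem idealization_nilPrime_wrt_two_smul {R M : Type*} [CommRing R] [AddCommGroup M]
    [Module R M] [Module Rᵐᵒᵖ M] [IsCentralScalar R M]
    (P : Ideal R) (N : Submodule R M) (hN : N ≠ ⊤)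
    (hPM : ∀ p ∈ P, ∀ m : M, p • m ∈ N)
    (Q : Ideal (TrivSqZeroExt R M))
    (hQ : ∀ z : TrivSqZeroExt R M, z ∈ Q ↔ z.fst ∈ P ∧ z.snd ∈ N)
    (x : R) (m : M)
    (hnil : (inl x + inr m : TrivSqZeroExt R M) ∈ nilradical (TrivSqZeroExt R M))
    (hQtop : Q ≠ ⊤)
    (h : ∀ a b : TrivSqZeroExt R M, a * b ∈ Q →
      a ∈ Q ∨ b ∈ Q ∨ a + (inl x + inr m) ∈ Q ∨ b + (inl x + inr m) ∈ Q) :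
    ∀ m₁ : M, m₁ ∉ N → 2 • m₁ ∈ N := by
  have key : ∀ n : M, n ∉ N → n + m ∈ N := by
    intro n hn
    have hprod : (inr n * inr n : TrivSqZeroExt R M) ∈ Q := by
      rw [inr_mul_inr]
      exact Q.zero_mem
    have hnQ : (inr n : TrivSqZeroExt R M) ∉ Q := fun hmem =>
      hn (by simpa using ((hQ _).1 hmem).2)
    have hadd : (inr n + (inl x + inr m) : TrivSqZeroExt R M) ∈ Q := by
      have hcases := h _ _ hprod
      tauto
    simpa using ((hQ _).1 hadd).2
  intro m₁ hm₁
  have hsub := N.sub_mem (key m₁ hm₁) (key (-m₁) (by rwa [N.neg_mem_iff]))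
  have heq : m₁ + m - (-m₁ + m) = 2 • m₁ := by abel
  rwa [heq] at hsub
end

section
/- Let R be a commutative ring with identity, M an R-module, P an ideal of R, and N a submodule of M such that PM ⊆ N. If the homogeneous ideal P ⊕ N is a nil-prime ideal of the idealization R ⊕ M, then P is a nil-prime ideal of R. -/
open TrivSqZeroExt

theorem isNilPrime_of_idealization_isNilPrime {R M : Type*} [CommRing R] [AddCommGroup M]
    [Module R M] [Module Rᵐᵒᵖ M] [IsCentralScalar R M]
    (P : Ideal R) (N : Submodule R M)
    (hPM : ∀ p ∈ P, ∀ m : M, p • m ∈ N)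
    (Q : Ideal (TrivSqZeroExt R M))
    (hQ : ∀ z : TrivSqZeroExt R M, z ∈ Q ↔ z.fst ∈ P ∧ z.snd ∈ N)
    (h : IsNilPrime Q) : IsNilPrime P := by
  obtain ⟨hne, s, hs, hprime⟩ := h
  refine ⟨?_, s.fst, ?_, fun a b hab => ?_⟩
  · rintro rfl
    refine hne ((Ideal.eq_top_iff_one Q).2 ((hQ 1).2 ⟨Submodule.mem_top, ?_⟩))
    rw [snd_one]
    exact N.zero_mem
  · rw [mem_nilradical] at hs ⊢
    exact hs.map (fstHom R R M)
  · have hmul : (inl a * inl b : TrivSqZeroExt R M) ∈ Q := by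
      rw [← inl_mul, hQ, fst_inl, snd_inl]
      exact ⟨hab, N.zero_mem⟩
    simpa using (hprime _ _ hmul).imp (fun h => ((hQ _).1 h).1)
      (Or.imp (fun h => ((hQ _).1 h).1)
        (Or.imp (fun h => ((hQ _).1 h).1) (fun h => ((hQ _).1 h).1)))
end

section
/- Let R be a commutative ring with identity and M an R-module. If P is a nil-prime ideal of R, then the ideal P ⊕ M is a nil-prime ideal of the idealization R ⊕ M. -/
open TrivSqZeroExt

theorem idealization_isNilPrime_of_isNilPrime {R M : Type*} [CommRing R] [AddCommGroup M]
    [Module R M] [Module Rᵐᵒᵖ M] [IsCentralScalar R M]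
    (P : Ideal R) (hP : IsNilPrime P)
    (Q : Ideal (TrivSqZeroExt R M))
    (hQ : ∀ z : TrivSqZeroExt R M, z ∈ Q ↔ z.fst ∈ P) :
    IsNilPrime Q := by
  obtain ⟨hP_ne, x, hx, h⟩ := hP
  refine ⟨fun hQ_top => hP_ne ?_, inl x, ?_, fun a b hab => ?_⟩
  · rw [Ideal.eq_top_iff_one] at hQ_top ⊢
    simpa using (hQ 1).mp hQ_top
  · exact (mem_nilradical.mp hx).map (inlHom R M)
  · simpa [hQ] using h a.fst b.fst (by simpa using (hQ (a * b)).mp hab)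
end

section
/- Let R be an Artinian commutative ring with identity. If P is an 𝔑-prime ideal of R, then P is an 𝔑-maximal ideal of R, i.e., for every ideal I with P ⊆ I ⊆ R, either I + Nil(R) = R or I ⊆ P + Nil(R). -/
/-- A proper ideal `P` of a commutative ring `R` is an *𝔑-prime ideal* if whenever
`a * b ∈ P`, we have `a ∈ P + Nil(R)` or `b ∈ P + Nil(R)`. -/
def IsNPrime {R : Type*} [CommRing R] (P : Ideal R) : Prop :=
  P ≠ ⊤ ∧ ∀ a b : R, a * b ∈ P → a ∈ P + nilradical R ∨ b ∈ P + nilradical R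

/-- If `x ^ n * (1 - x * y) = 0` and `x ^ n` lies in an ideal `J` containing the nilradical,
then `x` lies in `J`. -/
theorem Ideal.mem_of_pow_mem_of_pow_mul_one_sub_eq_zero {R : Type*} [CommRing R] {J : Ideal R}
    (hJ : nilradical R ≤ J) {x y : R} {n : ℕ} (hxy : x ^ n * (1 - x * y) = 0)
    (hx : x ^ n ∈ J) : x ∈ J := by
  have hnil : x * (1 - x * y) ∈ J := by
    refine hJ (mem_nilradical.mpr ⟨n + 1, ?_⟩)
    calc (x * (1 - x * y)) ^ (n + 1)
        = x ^ n * (1 - x * y) * (x * (1 - x * y) ^ n) := by rw [mul_pow]; ring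
      _ = 0 := by rw [hxy, zero_mul]
  clear hxy
  induction n with
  | zero => simpa using J.mul_mem_left x hx
  | succ k ih =>
    cases k with
    | zero => simpa using hx
    | succ m =>
      apply ih
      have h : x ^ (m + 1) = x ^ m * (x * (1 - x * y)) + y * x ^ (m + 1 + 1) := by ring
      rw [h]
      exact J.add_mem (J.mul_mem_left _ hnil) (J.mul_mem_left _ hx)

theorem nMaximal_of_nPrime_of_artinian {R : Type*} [CommRing R] [IsArtinianRing R]
    (P : Ideal R) (hP : IsNPrime P) :
    ∀ I : Ideal R, P ≤ I → I + nilradical R = ⊤ ∨ I ≤ P + nilradical R := by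
  intro I hPI
  refine or_iff_not_imp_right.mpr fun hI => ?_
  obtain ⟨x, hxI, hxP⟩ := SetLike.not_le_iff_exists.mp hI
  obtain ⟨n, y, hy⟩ := IsArtinian.exists_pow_succ_smul_dvd (M := R) x (1 : R)
  have hxy : x ^ n * (1 - x * y) = 0 := by
    simp only [smul_eq_mul, mul_one, Nat.succ_eq_add_one] at hy
    rw [← sub_eq_zero.mpr hy.symm]
    ring
  rcases hP.2 _ _ (hxy ▸ P.zero_mem) with h | h
  · exact absurd (Ideal.mem_of_pow_mem_of_pow_mul_one_sub_eq_zero le_sup_right hxy h) hxP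
  · rw [Ideal.eq_top_iff_one, ← sub_add_cancel 1 (x * y)]
    exact add_mem (sup_le_sup_right hPI _ h) (Ideal.mem_sup_left (I.mul_mem_right y hxI))
end

section
/- Let R be an Artinian commutative ring with identity. Then every set of nil-maximal ideals of R that are pairwise nil-distinct is finite. -/
/-- Two ideals `I` and `J` of `R` are *nil-distinct* if `J ⊄ I + Rz` and `I ⊄ J + Rz`
for each nilpotent element `z`. -/
def NilDistinct {R : Type*} [CommRing R] (I J : Ideal R) : Prop :=
  ∀ z ∈ nilradical R, ¬ J ≤ I + Ideal.span {z} ∧ ¬ I ≤ J + Ideal.span {z}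

/-- A nil-maximal ideal becomes maximal after adjoining a suitable nilpotent element. -/
theorem IsNilMaximal.exists_isMaximal_add_span {R : Type*} [CommRing R] {M : Ideal R}
    (hM : IsNilMaximal M) : ∃ x ∈ nilradical R, (M + Ideal.span {x}).IsMaximal := by
  obtain ⟨hne, x, hx, h⟩ := hM
  refine ⟨x, hx, ?_⟩
  obtain ⟨m, hm, hMm⟩ := Ideal.exists_le_maximal M hne
  have hxm : M + Ideal.span {x} ≤ m :=
    sup_le hMm ((Ideal.span_singleton_le_iff_mem m).2 (nilradical_le_prime m hx))
  rcases h m hMm with rfl | rfl | rfl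
  · rwa [le_antisymm hxm le_sup_left]
  · exact hm
  · exact absurd rfl hm.ne_top

theorem finite_of_nilMaximal_pairwise_nilDistinct {R : Type*} [CommRing R]
    [IsArtinianRing R] (S : Set (Ideal R)) (hmax : ∀ M ∈ S, IsNilMaximal M)
    (hdist : S.Pairwise NilDistinct) : S.Finite := by
  choose! x hx hm using fun M hM => (hmax M hM).exists_isMaximal_add_span
  have hfin : {m : Ideal R | m.IsMaximal}.Finite := IsArtinianRing.setOfPred_isMaximal_finite R
  refine Set.Finite.of_injOn (f := fun M => M + Ideal.span {x M}) hm ?_ hfin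
  intro M hM N hN h
  by_contra hne
  have hle : N ≤ M + Ideal.span {x M} := le_sup_left.trans_eq h.symm
  exact (hdist hM hN hne (x M) (hx M hM)).1 hle
end

section
/- Let R be a commutative ring with identity and let I be a nil-minimal ideal of R such that I ⊄ Nil(R). Then I is a nil-principal ideal of R, i.e., I = Rr + Rx for some r ∈ R and some x ∈ Nil(R). -/
/-- A nonzero ideal `I` of a commutative ring `R` is a *nil-minimal ideal* if there exists a
nilpotent element `x` such that whenever `J` is an ideal with `0 ⊆ J ⊆ I`, then
`I = J + Rx` or `J = Rx`. -/
def IsNilMinimal {R : Type*} [CommRing R] (I : Ideal R) : Prop :=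
  I ≠ ⊥ ∧ ∃ x ∈ nilradical R, ∀ J : Ideal R, J ≤ I →
    I = J + Ideal.span {x} ∨ J = Ideal.span {x}

theorem nilPrincipal_of_nilMinimal {R : Type*} [CommRing R] (I : Ideal R)
    (hI : IsNilMinimal I) (hnil : ¬ I ≤ nilradical R) :
    ∃ r : R, ∃ x ∈ nilradical R, I = Ideal.span {r} + Ideal.span {x} := by
  obtain ⟨-, x, hx, h⟩ := hI
  obtain ⟨r, hrI, hr⟩ := SetLike.not_le_iff_exists.mp hnil
  refine ⟨r, x, hx, (h (Ideal.span {r}) ((Ideal.span_singleton_le_iff_mem I).mpr hrI)).resolve_right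
    fun hrx => hr ?_⟩
  exact (Ideal.span_singleton_le_iff_mem _).mp
    (hrx.trans_le ((Ideal.span_singleton_le_iff_mem _).mpr hx))
end

section
/- Let R be a commutative ring with identity and let I be a nil-minimal ideal of R such that I ⊄ Nil(R). Then the ideal quotient (Nil(R) :_R I) = {r ∈ R : rI ⊆ Nil(R)} is a maximal ideal of R. -/
theorem colon_nilradical_isMaximal_of_nilMinimal {R : Type*} [CommRing R] (I : Ideal R)
    (hI : IsNilMinimal I) (hnil : ¬ I ≤ nilradical R) :
    (Submodule.colon (nilradical R) I).IsMaximal := by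
  obtain ⟨hne, x, hx, h⟩ := hI
  have hx0 : Ideal.span {x} = ⊥ := by
    rcases h ⊥ bot_le with h1 | h1
    · rw [Submodule.add_eq_sup, bot_sup_eq] at h1
      exact absurd (h1.trans_le ((Ideal.span_singleton_le_iff_mem _).2 hx)) hnil
    · exact h1.symm
  rw [Ideal.isMaximal_iff]
  refine ⟨fun h1 => hnil fun i hi => ?_, fun J r hle hr hrJ => ?_⟩
  · simpa using Submodule.mem_colon.1 h1 i hi
  · rw [Submodule.mem_colon] at hr
    push Not at hr
    obtain ⟨i, hi, hri⟩ := hr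
    have hri0 : r * i ≠ 0 := fun h0 => hri (by simp [h0])
    have hspan : I = Ideal.span {r * i} := by
      rcases h _ ((Ideal.span_singleton_le_iff_mem _).2 (I.mul_mem_left r hi)) with h1 | h1
      · simpa [hx0] using h1
      · rw [hx0, Ideal.span_singleton_eq_bot] at h1
        exact absurd h1 hri0
    obtain ⟨s, hs⟩ := Ideal.mem_span_singleton'.1 (hspan ▸ hi : i ∈ Ideal.span {r * i})
    have hmem : 1 - s * r ∈ Submodule.colon (nilradical R) I := by
      refine Submodule.mem_colon.2 fun j hj => ?_
      obtain ⟨t, rfl⟩ := Ideal.mem_span_singleton'.1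
        (hspan ▸ hj : j ∈ Ideal.span {r * i})
      have hzero : (1 - s * r) • (t * (r * i)) = 0 := by
        rw [smul_eq_mul]
        linear_combination (-(t * r)) * hs
      rw [hzero]
      exact zero_mem _
    simpa using J.add_mem (hle hmem) (J.mul_mem_left s hrJ)
end
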